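/- Suppose ξ has span 1. Then there exist constants β, δ > 0 and c₂ > 0 such that F extends to an analytic function on Δ(β, δ) and for all x, z ∈ Δ(β, δ), |1 − x z Φ'(F(z))| ≥ c₂ |1 − x|. -/

import Mathlib

open scoped ENNReal BigOperators
open Set Filter

/-- Plane (ordered rooted) trees. -/
inductive PlaneTree : Type
  | node : List PlaneTree → PlaneTree

namespace PlaneTree

/-- The list of subtrees hanging off the root. -/
def children : PlaneTree → List PlaneTree
  | .node ts => ts

/-- The subtree rooted at a given position (sequence of child indices), if it exists. -/
def subtreeAt : PlaneTree → List ℕ → Option PlaneTree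
  | t, [] => some t
  | .node ts, i :: q =>
    match ts[i]? with
    | some t' => subtreeAt t' q
    | none => none

/-- The vertex set of a tree, with vertices identified with their positions. -/
def vertexSet (t : PlaneTree) : Set (List ℕ) := {q | (subtreeAt t q).isSome}

/-- The number of vertices of a tree. -/
noncomputable def size (t : PlaneTree) : ℕ := (vertexSet t).ncard

/-- The number of children of the vertex at position `q`. -/
def childCount (t : PlaneTree) (q : List ℕ) : ℕ :=
  ((subtreeAt t q).map fun t' => t'.children.length).getD 0

end PlaneTree

/-- Longest common prefix of two positions; this is the position of the last common
ancestor of the two vertices. -/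
def lca : List ℕ → List ℕ → List ℕ
  | a :: as, b :: bs => if a = b then a :: lca as bs else []
  | _, _ => []

/-- The distance from `v` up to the last common ancestor of `v` and `w`. -/
def dUp (v w : List ℕ) : ℕ := v.length - (lca v w).length

/-- The graph distance between the vertices at positions `v` and `w`. -/
def treeDist (v w : List ℕ) : ℕ := dUp v w + dUp w v

/-- The Galton–Watson probability of a given finite tree: the product, over all vertices,
of the probability that the offspring distribution takes the value given by the number of
children of the vertex. -/
noncomputable def gwProb (p : ℕ → ℝ≥0∞) (t : PlaneTree) : ℝ≥0∞ :=
  ∏ᶠ v ∈ PlaneTree.vertexSet t, p (PlaneTree.childCount t v)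

/-- `P(|𝒯| = n)` for the Galton–Watson tree `𝒯`. -/
noncomputable def probSize (p : ℕ → ℝ≥0∞) (n : ℕ) : ℝ≥0∞ :=
  ∑' t : PlaneTree, if PlaneTree.size t = n then gwProb p t else 0

/-- `E f(T_n)` where `T_n` is the Galton–Watson tree conditioned to have `n` vertices. -/
noncomputable def condExp (p : ℕ → ℝ≥0∞) (n : ℕ) (f : PlaneTree → ℝ≥0∞) : ℝ≥0∞ :=
  (∑' t : PlaneTree, if PlaneTree.size t = n then gwProb p t * f t else 0) / probSize p n

/-- The variance of the offspring distribution `p` (which has mean `1`). -/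
noncomputable def xiVar (p : ℕ → ℝ≥0∞) : ℝ≥0∞ :=
  ∑' k : ℕ, p k * ENNReal.ofReal (((k : ℝ) - 1) ^ 2)

/-- `P_k(t)`: the number of unordered pairs of vertices of `t` at graph distance `k`. -/
noncomputable def pairCount (t : PlaneTree) (k : ℕ) : ℕ :=
  {s : Set (List ℕ) | ∃ v w, v ∈ PlaneTree.vertexSet t ∧ w ∈ PlaneTree.vertexSet t ∧
    s = {v, w} ∧ treeDist v w = k}.ncard

/-- The singularity-analysis domain `Δ(β, δ)`. -/
def Delta (β δ : ℝ) : Set ℂ :=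
  {z : ℂ | ‖z‖ < 1 + δ ∧ z ≠ 1 ∧ Real.pi / 2 - β < |Complex.arg (z - 1)|}

/-- `F(z) = E z^{|𝒯|}`, the probability generating function of the total progeny. -/
noncomputable def Fgen (p : ℕ → ℝ≥0∞) (z : ℂ) : ℂ :=
  ∑' t : PlaneTree, ((gwProb p t).toReal : ℂ) * z ^ PlaneTree.size t

/-- `Φ'(w)`, the derivative of the probability generating function `Φ(w) = E w^ξ` of the
offspring distribution. -/
noncomputable def PhiDeriv (p : ℕ → ℝ≥0∞) (w : ℂ) : ℂ :=
  ∑' k : ℕ, (k : ℂ) * ((p k).toReal : ℂ) * w ^ (k - 1)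

open scoped Topology

/-- The properties of the (real) weights of a critical offspring distribution with finite positive
variance and span one; `span` is in the form that the weights of `ξ` force a root of unity to be
trivial. -/
structure CriticalWeights (q : ℕ → ℝ) : Prop where
  nonneg : ∀ k, 0 ≤ q k
  hasSum_one : HasSum q 1
  hasSum_mean : HasSum (fun k : ℕ => (k : ℝ) * q k) 1
  summable_sq : Summable fun k : ℕ => (k : ℝ) ^ 2 * q k
  zero_pos : 0 < q 0
  exists_two_le : ∃ k, 2 ≤ k ∧ 0 < q k
  span : ∀ w : ℂ, (∀ k, q k ≠ 0 → w ^ k = 1) → w = 1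

/-- The probability generating function with weights `q`. -/
noncomputable def pgf (q : ℕ → ℝ) (w : ℂ) : ℂ := ∑' k : ℕ, (q k : ℂ) * w ^ k

/-- The termwise derivative of `pgf q`. -/
noncomputable def pgfDeriv (q : ℕ → ℝ) (w : ℂ) : ℂ :=
  ∑' k : ℕ, (k : ℂ) * (q k : ℂ) * w ^ (k - 1)

/-- The quotient `(pgf q w - w) / (1 - w) ^ 2` of the second-order Taylor expansion at `1`. -/
noncomputable def pgfQuot (q : ℕ → ℝ) (w : ℂ) : ℂ :=
  ∑' k : ℕ, (q k : ℂ) * ∑ j ∈ Finset.range k, ∑ i ∈ Finset.range j, w ^ i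

/-- The quotient `(1 - pgfDeriv q w) / (1 - w)` of the first-order expansion at `1`. -/
noncomputable def pgfDerivQuot (q : ℕ → ℝ) (w : ℂ) : ℂ :=
  ∑' k : ℕ, (k : ℂ) * (q k : ℂ) * ∑ i ∈ Finset.range (k - 1), w ^ i

/-- The second factorial moment. -/
noncomputable def factorialMoment (q : ℕ → ℝ) : ℝ := ∑' k : ℕ, (k : ℝ) * q k * ((k - 1 : ℕ) : ℝ)

theorem norm_sum_pow_le {w : ℂ} (hw : ‖w‖ ≤ 1) (n : ℕ) : ‖∑ i ∈ Finset.range n, w ^ i‖ ≤ n := by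
  refine (norm_sum_le _ _).trans ?_
  refine (Finset.sum_le_card_nsmul _ _ 1 fun i _ => ?_).trans (by simp)
  rw [norm_pow]
  exact pow_le_one₀ (norm_nonneg _) hw

theorem norm_sum_sum_pow_le {w : ℂ} (hw : ‖w‖ ≤ 1) (n : ℕ) :
    ‖∑ j ∈ Finset.range n, ∑ i ∈ Finset.range j, w ^ i‖ ≤ (n : ℝ) ^ 2 := by
  refine (norm_sum_le _ _).trans ?_
  refine (Finset.sum_le_card_nsmul _ _ (n : ℝ) fun i hi => ?_).trans (by simp [sq])
  exact (norm_sum_pow_le hw i).trans (by exact_mod_cast (Finset.mem_range.1 hi).le)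

/-- The second-order expansion of a power at `1`, with explicit remainder. -/
theorem pow_eq_one_add_sq_mul (w : ℂ) (k : ℕ) :
    w ^ k = 1 + k * (w - 1) +
      (1 - w) ^ 2 * ∑ j ∈ Finset.range k, ∑ i ∈ Finset.range j, w ^ i := by
  have h1 : ∀ n : ℕ, w ^ n = 1 + (w - 1) * ∑ i ∈ Finset.range n, w ^ i := fun n => by
    rw [mul_geom_sum]; ring
  have h2 : ∑ j ∈ Finset.range k, w ^ j =
      k + (w - 1) * ∑ j ∈ Finset.range k, ∑ i ∈ Finset.range j, w ^ i := by
    rw [Finset.mul_sum, Finset.sum_congr rfl fun j _ => h1 j, Finset.sum_add_distrib]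
    simp
  rw [h1 k, h2]; ring

theorem norm_pow_sub_pow_le {w v : ℂ} (hw : ‖w‖ ≤ 1) (hv : ‖v‖ ≤ 1) (k : ℕ) :
    ‖w ^ k - v ^ k‖ ≤ k * ‖w - v‖ := by
  rw [← (Commute.all w v).geom_sum₂_mul, norm_mul]
  gcongr
  refine (norm_sum_le _ _).trans ?_
  refine (Finset.sum_le_card_nsmul _ _ 1 fun i _ => ?_).trans (by simp)
  rw [norm_mul, norm_pow, norm_pow]
  exact mul_le_one₀ (pow_le_one₀ (norm_nonneg _) hw) (by positivity)
    (pow_le_one₀ (norm_nonneg _) hv)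

theorem norm_pow_sub_pow_lt {w v : ℂ} (hw : ‖w‖ < 1) (hv : ‖v‖ ≤ 1) (hne : w ≠ v) {k : ℕ}
    (hk : 2 ≤ k) : ‖w ^ k - v ^ k‖ < k * ‖w - v‖ := by
  rw [← (Commute.all w v).geom_sum₂_mul, norm_mul]
  refine mul_lt_mul_of_pos_right ?_ (norm_pos_iff.2 (sub_ne_zero.2 hne))
  have hle : ∀ i, ‖w ^ i * v ^ (k - 1 - i)‖ ≤ ‖w‖ ^ i := fun i => by
    rw [norm_mul, norm_pow, norm_pow]
    exact mul_le_of_le_one_right (by positivity) (pow_le_one₀ (norm_nonneg _) hv)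
  refine (norm_sum_le _ _).trans_lt ?_
  calc _ < ∑ i ∈ Finset.range k, (1 : ℝ) := by
        refine Finset.sum_lt_sum (fun i _ => (hle i).trans (pow_le_one₀ (norm_nonneg _) hw.le))
          ⟨1, Finset.mem_range.2 (by omega), (hle 1).trans_lt (by simpa using hw)⟩
    _ = k := by simp

namespace CriticalWeights

theorem norm_term_le {q : ℕ → ℝ} (hq : CriticalWeights q)
    {w : ℂ} (hw : ‖w‖ ≤ 1) (k : ℕ) : ‖(q k : ℂ) * w ^ k‖ ≤ q k := by
  rw [norm_mul, norm_pow, Complex.norm_real, Real.norm_of_nonneg (hq.nonneg k)]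
  exact mul_le_of_le_one_right (hq.nonneg k) (pow_le_one₀ (norm_nonneg _) hw)

theorem summable_term {q : ℕ → ℝ} (hq : CriticalWeights q)
    {w : ℂ} (hw : ‖w‖ ≤ 1) : Summable fun k => (q k : ℂ) * w ^ k :=
  .of_norm_bounded hq.hasSum_one.summable (hq.norm_term_le hw)

theorem norm_pgf_le {q : ℕ → ℝ} (hq : CriticalWeights q) {w : ℂ} (hw : ‖w‖ ≤ 1) : ‖pgf q w‖ ≤ 1 :=
  tsum_of_norm_bounded hq.hasSum_one (hq.norm_term_le hw)

theorem continuousOn_pgf {q : ℕ → ℝ} (hq : CriticalWeights q)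
    : ContinuousOn (pgf q) (Metric.closedBall 0 1) :=
  continuousOn_tsum (fun k => by fun_prop) hq.hasSum_one.summable
    fun k w hw => hq.norm_term_le (by simpa using hw) k

theorem pgf_one {q : ℕ → ℝ} (hq : CriticalWeights q) : pgf q 1 = 1 := by
  simp only [pgf, one_pow, mul_one]
  exact_mod_cast (Complex.hasSum_ofReal.2 hq.hasSum_one).tsum_eq

theorem pgf_zero (q : ℕ → ℝ) : pgf q 0 = q 0 := by
  rw [pgf, tsum_eq_single 0 (fun k hk => by simp [hk])]
  simp

theorem norm_deriv_term_le {q : ℕ → ℝ} (hq : CriticalWeights q) {w : ℂ} (hw : ‖w‖ ≤ 1) (k : ℕ) :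
    ‖(k : ℂ) * (q k : ℂ) * w ^ (k - 1)‖ ≤ k * q k := by
  rw [norm_mul, norm_mul, norm_pow, Complex.norm_real, Real.norm_of_nonneg (hq.nonneg k),
    Complex.norm_natCast]
  exact mul_le_of_le_one_right (mul_nonneg k.cast_nonneg (hq.nonneg k))
    (pow_le_one₀ (norm_nonneg _) hw)

theorem continuousOn_pgfDeriv {q : ℕ → ℝ} (hq : CriticalWeights q)
    : ContinuousOn (pgfDeriv q) (Metric.closedBall 0 1) :=
  continuousOn_tsum (fun k => by fun_prop) hq.hasSum_mean.summable
    fun k w hw => hq.norm_deriv_term_le (by simpa using hw) k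

theorem hasDerivAt_pgf {q : ℕ → ℝ} (hq : CriticalWeights q)
    {w : ℂ} (hw : ‖w‖ < 1) : HasDerivAt (pgf q) (pgfDeriv q w) w := by
  refine hasDerivAt_tsum_of_isPreconnected (t := Metric.ball 0 1)
    (g' := fun (k : ℕ) y => (k : ℂ) * (q k : ℂ) * y ^ (k - 1)) hq.hasSum_mean.summable
    Metric.isOpen_ball (convex_ball _ _).isPreconnected (fun k y _ => ?_)
    (fun k y hy => hq.norm_deriv_term_le (by simpa using (mem_ball_zero_iff.1 hy).le) k)
    (Metric.mem_ball_self one_pos) (hq.summable_term (by simp)) (by simpa using hw)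
  convert! (hasDerivAt_pow k y).const_mul (q k : ℂ) using 1
  ring

theorem norm_pgfDeriv_lt_one {q : ℕ → ℝ} (hq : CriticalWeights q)
    {w : ℂ} (hw : ‖w‖ < 1) : ‖pgfDeriv q w‖ < 1 := by
  obtain ⟨k, hk, hqk⟩ := hq.exists_two_le
  have hs : Summable fun k : ℕ => ‖(k : ℂ) * (q k : ℂ) * w ^ (k - 1)‖ :=
    .of_nonneg_of_le (fun _ => norm_nonneg _) (hq.norm_deriv_term_le hw.le)
      hq.hasSum_mean.summable
  refine (norm_tsum_le_tsum_norm hs).trans_lt ?_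
  rw [← hq.hasSum_mean.tsum_eq]
  refine hs.tsum_lt_tsum (i := k) (hq.norm_deriv_term_le hw.le) ?_ hq.hasSum_mean.summable
  rw [norm_mul, norm_mul, norm_pow, Complex.norm_real, Real.norm_of_nonneg (hq.nonneg k),
    Complex.norm_natCast]
  exact mul_lt_of_lt_one_right (by positivity) (pow_lt_one₀ (norm_nonneg _) hw (by omega))

theorem norm_pgf_sub_lt {q : ℕ → ℝ} (hq : CriticalWeights q)
    {w v : ℂ} (hw : ‖w‖ < 1) (hv : ‖v‖ ≤ 1) (hne : w ≠ v) :
    ‖pgf q w - pgf q v‖ < ‖w - v‖ := by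
  obtain ⟨k, hk, hqk⟩ := hq.exists_two_le
  have hle : ∀ k : ℕ, ‖(q k : ℂ) * w ^ k - q k * v ^ k‖ ≤ k * q k * ‖w - v‖ := fun k => by
    rw [← mul_sub, norm_mul, Complex.norm_real, Real.norm_of_nonneg (hq.nonneg k)]
    nlinarith [norm_pow_sub_pow_le hw.le hv k, hq.nonneg k]
  have hm := hq.hasSum_mean.mul_right ‖w - v‖
  have hs : Summable fun k : ℕ => ‖(q k : ℂ) * w ^ k - q k * v ^ k‖ :=
    .of_nonneg_of_le (fun _ => norm_nonneg _) hle hm.summable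
  rw [pgf, pgf, ← (hq.summable_term hw.le).tsum_sub (hq.summable_term hv)]
  refine (norm_tsum_le_tsum_norm hs).trans_lt ?_
  refine (hs.tsum_lt_tsum (i := k) hle ?_ hm.summable).trans_eq (by rw [hm.tsum_eq, one_mul])
  rw [← mul_sub, norm_mul, Complex.norm_real, Real.norm_of_nonneg (hq.nonneg k)]
  nlinarith [norm_pow_sub_pow_lt hw hv hne hk]

theorem eq_one_of_norm_pgf_eq_one {q : ℕ → ℝ} (hq : CriticalWeights q)
    {w : ℂ} (hw : ‖w‖ ≤ 1) (h : ‖pgf q w‖ = 1) : w = 1 := by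
  set c := pgf q w with hc
  have hsum : HasSum (fun k => q k * (1 - (starRingEnd ℂ c * w ^ k).re)) 0 := by
    have h1 := Complex.hasSum_re ((hq.summable_term hw).hasSum.mul_left (starRingEnd ℂ c))
    have h2 := hq.hasSum_one.sub h1
    have h3 : (starRingEnd ℂ c * ∑' k, (q k : ℂ) * w ^ k).re = 1 := by
      change (starRingEnd ℂ c * c).re = 1
      rw [mul_comm, Complex.mul_conj, Complex.normSq_eq_norm_sq, h]
      simp
    rw [h3, sub_self] at h2
    convert! h2 using 2 with k
    rw [mul_left_comm, Complex.re_ofReal_mul]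
    ring
  have hnorm : ∀ k, ‖starRingEnd ℂ c * w ^ k‖ ≤ 1 := fun k => by
    rw [norm_mul, RCLike.norm_conj, h, one_mul, norm_pow]
    exact pow_le_one₀ (norm_nonneg _) hw
  have hre : ∀ k, q k ≠ 0 → starRingEnd ℂ c * w ^ k = 1 := fun k hk => by
    have h0 := (hasSum_zero_iff_of_nonneg fun k => mul_nonneg (hq.nonneg k)
      (sub_nonneg.2 ((Complex.re_le_norm _).trans (hnorm k)))).1 hsum
    have h1 : (starRingEnd ℂ c * w ^ k).re = 1 := by
      have := congrFun h0 k
      simp only [Pi.zero_apply, mul_eq_zero, hk, false_or] at this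
      linarith
    have h2 := hnorm k
    rw [← sq_le_one_iff₀ (norm_nonneg _), ← Complex.normSq_eq_norm_sq, Complex.normSq_apply,
      h1] at h2
    exact Complex.ext h1 (by rw [Complex.one_im]; nlinarith)
  have hc1 : starRingEnd ℂ c = 1 := by simpa using hre 0 hq.zero_pos.ne'
  exact hq.span w fun k hk => by simpa [hc1] using hre k hk

/-- A solution of `w = z * pgf q w` lies inside the unit disc unless `z = 1`. -/
theorem norm_lt_one_of_eq {q : ℕ → ℝ} (hq : CriticalWeights q)
    {z w : ℂ} (hz : ‖z‖ ≤ 1) (hz1 : z ≠ 1) (hw : ‖w‖ ≤ 1)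
    (h : w = z * pgf q w) : ‖w‖ < 1 := by
  refine lt_of_le_of_ne hw fun hw1 => hz1 ?_
  have h1 : ‖w‖ = ‖z‖ * ‖pgf q w‖ := by rw [← norm_mul, ← h]
  have h2 := hq.norm_pgf_le hw
  have h3 : ‖pgf q w‖ = 1 := by nlinarith [norm_nonneg z, norm_nonneg (pgf q w)]
  have h4 := hq.eq_one_of_norm_pgf_eq_one hw h3
  rw [h4, hq.pgf_one, mul_one] at h
  exact h.symm

theorem eq_of_eq {q : ℕ → ℝ} (hq : CriticalWeights q)
    {z w v : ℂ} (hz : ‖z‖ ≤ 1) (hw : ‖w‖ ≤ 1) (hv : ‖v‖ ≤ 1)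
    (hwz : w = z * pgf q w) (hvz : v = z * pgf q v) : w = v := by
  have key : ∀ w v : ℂ, ‖w‖ < 1 → ‖v‖ ≤ 1 → w = z * pgf q w → v = z * pgf q v → w = v := by
    intro w v hw hv hwz hvz
    by_contra hne
    have h1 := hq.norm_pgf_sub_lt hw hv hne
    have h2 : ‖w - v‖ = ‖z‖ * ‖pgf q w - pgf q v‖ := by rw [← norm_mul, mul_sub, ← hwz, ← hvz]
    nlinarith [norm_nonneg (pgf q w - pgf q v)]
  rcases eq_or_ne z 1 with rfl | hz1
  · have : ∀ w : ℂ, ‖w‖ ≤ 1 → w = 1 * pgf q w → w = 1 := fun w hw h => by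
      rcases hw.lt_or_eq with hlt | heq
      · exact key w 1 hlt (by simp) h (by simp [hq.pgf_one])
      · exact hq.eq_one_of_norm_pgf_eq_one hw (by rw [← heq]; conv_rhs => rw [h, one_mul])
    rw [this w hw hwz, this v hv hvz]
  · exact key w v (hq.norm_lt_one_of_eq hz hz1 hw hwz) hv hwz hvz

theorem pgf_ne_zero_of_eq {q : ℕ → ℝ} (hq : CriticalWeights q)
    {z w : ℂ} (h : w = z * pgf q w) : pgf q w ≠ 0 := fun h0 => by
  rw [h0, mul_zero] at h
  rw [h, pgf_zero] at h0
  exact hq.zero_pos.ne' (by exact_mod_cast h0)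

theorem continuousOn_pgfQuot {q : ℕ → ℝ} (hq : CriticalWeights q)
    : ContinuousOn (pgfQuot q) (Metric.closedBall 0 1) := by
  refine continuousOn_tsum (fun k => by fun_prop) hq.summable_sq fun k w hw => ?_
  rw [norm_mul, Complex.norm_real, Real.norm_of_nonneg (hq.nonneg k), mul_comm]
  exact mul_le_mul_of_nonneg_right (norm_sum_sum_pow_le (by simpa using hw) k) (hq.nonneg k)

theorem norm_derivQuot_term_le {q : ℕ → ℝ} (hq : CriticalWeights q) {w : ℂ} (hw : ‖w‖ ≤ 1) (k : ℕ) :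
    ‖(k : ℂ) * (q k : ℂ) * ∑ i ∈ Finset.range (k - 1), w ^ i‖ ≤ (k : ℝ) ^ 2 * q k := by
  rw [norm_mul, norm_mul, Complex.norm_real, Real.norm_of_nonneg (hq.nonneg k),
    Complex.norm_natCast]
  have h1 := norm_sum_pow_le hw (k - 1)
  have h2 : ((k - 1 : ℕ) : ℝ) ≤ k := by exact_mod_cast Nat.sub_le k 1
  have h3 := mul_nonneg k.cast_nonneg (hq.nonneg k) (α := ℝ)
  nlinarith

theorem continuousOn_pgfDerivQuot {q : ℕ → ℝ} (hq : CriticalWeights q)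
    : ContinuousOn (pgfDerivQuot q) (Metric.closedBall 0 1) :=
  continuousOn_tsum (fun k => by fun_prop) hq.summable_sq
    fun k w hw => hq.norm_derivQuot_term_le (by simpa using hw) k

theorem pgf_eq {q : ℕ → ℝ} (hq : CriticalWeights q)
    {w : ℂ} (hw : ‖w‖ ≤ 1) : pgf q w = w + (1 - w) ^ 2 * pgfQuot q w := by
  have hs : Summable fun k : ℕ => (q k : ℂ) * ∑ j ∈ Finset.range k, ∑ i ∈ Finset.range j, w ^ i :=
    .of_norm_bounded hq.summable_sq fun k => by
      rw [norm_mul, Complex.norm_real, Real.norm_of_nonneg (hq.nonneg k), mul_comm]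
      exact mul_le_mul_of_nonneg_right (norm_sum_sum_pow_le hw k) (hq.nonneg k)
  have h1 := Complex.hasSum_ofReal.2 hq.hasSum_one
  have h2 := (Complex.hasSum_ofReal.2 hq.hasSum_mean).mul_right (w - 1)
  have h3 := ((h1.add h2).add (hs.hasSum.mul_left ((1 - w) ^ 2))).tsum_eq
  rw [pgf, pgfQuot, ← sub_eq_zero, ← sub_eq_zero.2 h3]
  have : ∀ k : ℕ, (q k : ℂ) * w ^ k = (q k : ℂ) + ((k * q k : ℝ) : ℂ) * (w - 1) +
      (1 - w) ^ 2 * ((q k : ℂ) * ∑ j ∈ Finset.range k, ∑ i ∈ Finset.range j, w ^ i) := fun k => by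
    rw [pow_eq_one_add_sq_mul w k]; push_cast; ring
  rw [tsum_congr this]; push_cast; ring

theorem pgfDeriv_eq {q : ℕ → ℝ} (hq : CriticalWeights q) {w : ℂ} (hw : ‖w‖ ≤ 1) :
    pgfDeriv q w = 1 - (1 - w) * pgfDerivQuot q w := by
  have hs : Summable fun k : ℕ => (k : ℂ) * (q k : ℂ) * ∑ i ∈ Finset.range (k - 1), w ^ i :=
    .of_norm_bounded hq.summable_sq (hq.norm_derivQuot_term_le hw)
  have h1 := Complex.hasSum_ofReal.2 hq.hasSum_mean
  have h3 := (h1.sub (hs.hasSum.mul_left (1 - w))).tsum_eq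
  rw [Complex.ofReal_one] at h3
  rw [pgfDeriv, pgfDerivQuot, ← h3]
  refine tsum_congr fun k => ?_
  have : w ^ (k - 1) = 1 - (1 - w) * ∑ i ∈ Finset.range (k - 1), w ^ i := by
    rw [mul_neg_geom_sum]; ring
  rw [this]; push_cast; ring

theorem summable_factorialMoment {q : ℕ → ℝ} (hq : CriticalWeights q) :
    Summable fun k : ℕ => (k : ℝ) * q k * ((k - 1 : ℕ) : ℝ) := by
  refine .of_nonneg_of_le (fun k => ?_) (fun k => ?_) hq.summable_sq
  · exact mul_nonneg (mul_nonneg k.cast_nonneg (hq.nonneg k)) (Nat.cast_nonneg _)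
  · have h2 : ((k - 1 : ℕ) : ℝ) ≤ k := by exact_mod_cast Nat.sub_le k 1
    have h3 := mul_nonneg k.cast_nonneg (hq.nonneg k) (α := ℝ)
    nlinarith

theorem factorialMoment_pos {q : ℕ → ℝ} (hq : CriticalWeights q) : 0 < factorialMoment q := by
  obtain ⟨k, hk, hqk⟩ := hq.exists_two_le
  refine hq.summable_factorialMoment.tsum_pos (fun k => ?_) k ?_
  · exact mul_nonneg (mul_nonneg k.cast_nonneg (hq.nonneg k)) (Nat.cast_nonneg _)
  · have : 0 < k - 1 := by omega
    positivity

theorem pgfDerivQuot_one (q : ℕ → ℝ) : pgfDerivQuot q 1 = factorialMoment q := by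
  rw [pgfDerivQuot, factorialMoment, Complex.ofReal_tsum]
  refine tsum_congr fun k => ?_
  simp

theorem pgfQuot_one (q : ℕ → ℝ) : pgfQuot q 1 = factorialMoment q / 2 := by
  rw [pgfQuot, factorialMoment, Complex.ofReal_tsum, ← tsum_div_const]
  refine tsum_congr fun k => ?_
  have : (∑ j ∈ Finset.range k, (j : ℂ)) * 2 = k * ((k - 1 : ℕ) : ℂ) := by
    have := congrArg (Nat.cast (R := ℂ)) (Finset.sum_range_id_mul_two k)
    push_cast at this ⊢
    exact this
  simp only [one_pow, Finset.sum_const, Finset.card_range, nsmul_eq_mul, mul_one]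
  push_cast
  linear_combination (q k : ℂ) / 2 * this

end CriticalWeights

/-- `w` is a solution of `w = z * pgf q w` in the open unit disc. -/
def IsSolution (q : ℕ → ℝ) (z w : ℂ) : Prop := ‖w‖ < 1 ∧ w = z * pgf q w

/-- `z` has a unique solution, and there the multiplier `z * pgfDeriv q w` is at most `1 - η`. -/
def IsContractive (q : ℕ → ℝ) (η : ℝ) (z : ℂ) : Prop :=
  (∃! w, IsSolution q z w) ∧ ∀ w, IsSolution q z w → ‖z * pgfDeriv q w‖ ≤ 1 - η

namespace CriticalWeights

theorem eventually_ne_mul_pgf {q : ℕ → ℝ} (hq : CriticalWeights q) {K : Set ℂ}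
    (hK : IsCompact K) (hK1 : K ⊆ Metric.closedBall 0 1) {z₀ : ℂ}
    (h : ∀ w ∈ K, w ≠ z₀ * pgf q w) : ∀ᶠ z in 𝓝 z₀, ∀ w ∈ K, w ≠ z * pgf q w := by
  rcases K.eq_empty_or_nonempty with rfl | hne
  · simp
  have hc : ContinuousOn (fun w => ‖w - z₀ * pgf q w‖) K :=
    (continuousOn_id.sub (continuousOn_const.mul (hq.continuousOn_pgf.mono hK1))).norm
  obtain ⟨w₁, hw₁, hmin⟩ := hK.exists_isMinOn hne hc
  have hpos : 0 < ‖w₁ - z₀ * pgf q w₁‖ := norm_pos_iff.2 (sub_ne_zero.2 (h w₁ hw₁))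
  filter_upwards [Metric.ball_mem_nhds z₀ hpos] with z hz w hw heq
  have h1 : ‖w₁ - z₀ * pgf q w₁‖ ≤ ‖w - z₀ * pgf q w‖ := hmin hw
  have h2 : w - z₀ * pgf q w = (z - z₀) * pgf q w := by linear_combination heq
  have h3 := hq.norm_pgf_le (w := w) (by simpa using hK1 hw)
  rw [h2, norm_mul] at h1
  rw [mem_ball_iff_norm] at hz
  nlinarith [norm_nonneg (z - z₀)]

theorem eventually_solution_close {q : ℕ → ℝ} (hq : CriticalWeights q) {z₀ w₀ : ℂ}
    (huniq : ∀ w, ‖w‖ ≤ 1 → w = z₀ * pgf q w → w = w₀) {ε : ℝ} (hε : 0 < ε) :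
    ∀ᶠ z in 𝓝 z₀, ∀ w, ‖w‖ ≤ 1 → w = z * pgf q w → ‖w - w₀‖ < ε := by
  have hK : IsCompact (Metric.closedBall (0 : ℂ) 1 \ Metric.ball w₀ ε) :=
    (isCompact_closedBall _ _).diff Metric.isOpen_ball
  have h := hq.eventually_ne_mul_pgf hK sdiff_subset (z₀ := z₀) fun w hw heq => by
    have := huniq w (by simpa using hw.1) heq
    exact hw.2 (this ▸ Metric.mem_ball_self hε)
  filter_upwards [h] with z hz w hw heq
  by_contra hcon
  exact hz w ⟨by simpa using hw, by simpa [dist_eq_norm] using hcon⟩ heq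

theorem isClosed_solvable {q : ℕ → ℝ} (hq : CriticalWeights q) :
    IsClosed {z : ℂ | ∃ w, ‖w‖ ≤ 1 ∧ w = z * pgf q w} := by
  rw [← isOpen_compl_iff, isOpen_iff_eventually]
  intro z₀ hz₀
  have h := hq.eventually_ne_mul_pgf (isCompact_closedBall (0 : ℂ) 1) subset_rfl (z₀ := z₀)
    fun w hw heq => hz₀ ⟨w, by simpa using hw, heq⟩
  filter_upwards [h] with z hz
  rintro ⟨w, hw, heq⟩
  exact hz w (by simpa using hw) heq

/-- Through a solution at which `z * pgfDeriv q w ≠ 1` passes a local differentiable branch of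
solutions. -/
theorem exists_local_branch {q : ℕ → ℝ} (hq : CriticalWeights q) {z₀ w₀ : ℂ}
    (h : IsSolution q z₀ w₀) (hd : z₀ * pgfDeriv q w₀ ≠ 1) :
    ∃ g : ℂ → ℂ, DifferentiableAt ℂ g z₀ ∧ ∀ᶠ z in 𝓝 z₀, IsSolution q z (g z) := by
  have hΦ := hq.pgf_ne_zero_of_eq h.2
  set G : ℂ → ℂ := fun w => w / pgf q w with hG
  have hball : ∀ᶠ w in 𝓝 w₀, ‖w‖ < 1 := continuous_norm.continuousAt.eventually_lt_const h.1
  have hanΦ : AnalyticAt ℂ (pgf q) w₀ :=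
    Complex.analyticAt_iff_eventually_differentiableAt.2
      (hball.mono fun w hw => (hq.hasDerivAt_pgf hw).differentiableAt)
  have hGz : G w₀ = z₀ := by
    rw [hG]; exact (div_eq_iff hΦ).2 h.2
  have hder : HasDerivAt G ((1 - z₀ * pgfDeriv q w₀) / pgf q w₀) w₀ := by
    convert! (hasDerivAt_id w₀).div (hq.hasDerivAt_pgf h.1) hΦ using 1
    rw [div_eq_div_iff hΦ (pow_ne_zero 2 hΦ)]
    simp only [id]
    linear_combination (pgf q w₀) * (pgfDeriv q w₀) * h.2
  have hstrict : HasStrictDerivAt G ((1 - z₀ * pgfDeriv q w₀) / pgf q w₀) w₀ := by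
    have := (analyticAt_id.div hanΦ hΦ).hasStrictDerivAt
    rwa [show deriv (id / pgf q) w₀ = _ from hder.deriv] at this
  have hne : (1 - z₀ * pgfDeriv q w₀) / pgf q w₀ ≠ 0 :=
    div_ne_zero (sub_ne_zero.2 hd.symm) hΦ
  have hgd := (hstrict.to_localInverse hne).hasDerivAt.differentiableAt
  have hright := hstrict.eventually_right_inverse (hf' := hne)
  have hval : hstrict.localInverse G _ w₀ hne (G w₀) = w₀ :=
    HasStrictFDerivAt.localInverse_apply_image ..
  rw [hGz] at hgd hright hval
  refine ⟨_, hgd, ?_⟩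
  have hcont := hgd.continuousAt
  rw [ContinuousAt, hval] at hcont
  filter_upwards [hright, hcont.eventually hball,
    hcont.eventually (hanΦ.continuousAt.eventually_ne hΦ)] with z h1 h2 h3
  exact ⟨h2, (div_eq_iff h3).1 h1⟩

theorem exists_eventually_isContractive {q : ℕ → ℝ} (hq : CriticalWeights q)
    (hex : ∀ z : ℂ, ‖z‖ < 1 → ∃ w, ‖w‖ ≤ 1 ∧ w = z * pgf q w) {z₀ : ℂ} (hz₀ : ‖z₀‖ ≤ 1)
    (hz₁ : z₀ ≠ 1) : ∃ η > 0, ∀ᶠ z in 𝓝 z₀, IsContractive q η z := by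
  obtain ⟨w₀, hw₀, heq₀⟩ : ∃ w, ‖w‖ ≤ 1 ∧ w = z₀ * pgf q w := by
    have : Metric.closedBall (0 : ℂ) 1 ⊆ {z : ℂ | ∃ w, ‖w‖ ≤ 1 ∧ w = z * pgf q w} := by
      rw [← closure_ball 0 one_ne_zero]
      exact closure_minimal (fun z hz => hex z (by simpa using hz)) hq.isClosed_solvable
    exact this (by simpa using hz₀)
  have hlt := hq.norm_lt_one_of_eq hz₀ hz₁ hw₀ heq₀
  have hd := hq.norm_pgfDeriv_lt_one hlt
  have hd' : ‖z₀ * pgfDeriv q w₀‖ < 1 := by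
    rw [norm_mul]; nlinarith [norm_nonneg z₀, norm_nonneg (pgfDeriv q w₀)]
  obtain ⟨η, hη, hη'⟩ : ∃ η > 0, ‖z₀ * pgfDeriv q w₀‖ < 1 - η :=
    ⟨(1 - ‖z₀ * pgfDeriv q w₀‖) / 2, by linarith, by linarith⟩
  refine ⟨η, hη, ?_⟩
  have hcd : ContinuousAt (pgfDeriv q) w₀ := hq.continuousOn_pgfDeriv.continuousAt
    (mem_of_superset (Metric.isOpen_ball.mem_nhds (by simpa using hlt)) Metric.ball_subset_closedBall)
  have hc : ContinuousAt (fun x : ℂ × ℂ => ‖x.1 * pgfDeriv q x.2‖) (z₀, w₀) :=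
    (continuousAt_fst.mul (ContinuousAt.comp (f := Prod.snd) (x := (z₀, w₀)) hcd
      continuousAt_snd)).norm
  have hev : ∀ᶠ x : ℂ × ℂ in 𝓝 (z₀, w₀), ‖x.1 * pgfDeriv q x.2‖ < 1 - η ∧ ‖x.2‖ < 1 :=
    (hc.eventually_lt_const hη').and
      (((continuous_norm.comp continuous_snd).continuousAt (x := (z₀, w₀))).eventually_lt_const hlt)
  obtain ⟨ε, hε, hball⟩ := Metric.eventually_nhds_iff_ball.1 hev
  have hbound : ∀ z ∈ Metric.ball z₀ ε, ∀ w ∈ Metric.ball w₀ ε,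
      ‖z * pgfDeriv q w‖ < 1 - η ∧ ‖w‖ < 1 := fun z hz w hw =>
    hball (z, w) (by rw [← ball_prod_same]; exact ⟨hz, hw⟩)
  have hd1 : z₀ * pgfDeriv q w₀ ≠ 1 := fun h => by rw [h] at hd'; simp at hd'
  obtain ⟨g, -, hg⟩ := hq.exists_local_branch ⟨hlt, heq₀⟩ hd1
  filter_upwards [hg, Metric.ball_mem_nhds z₀ hε, hq.eventually_solution_close
    (fun w hw h => hq.eq_of_eq hz₀ hw hw₀ h heq₀) hε] with z hgz hz hclose
  have hmem : ∀ w, IsSolution q z w → w ∈ Metric.ball w₀ ε := fun w hw =>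
    mem_ball_iff_norm.2 (hclose w hw.1.le hw.2)
  refine ⟨⟨g z, hgz, fun w hw => ?_⟩, fun w hw => (hbound z hz w (hmem w hw)).1.le⟩
  have hle := (convex_ball w₀ ε).norm_image_sub_le_of_norm_hasDerivWithin_le
    (f := fun w => z * pgf q w) (f' := fun w => z * pgfDeriv q w) (C := 1 - η)
    (fun v hv => ((hq.hasDerivAt_pgf (hbound z hz v hv).2).const_mul z).hasDerivWithinAt)
    (fun v hv => (hbound z hz v hv).1.le) (hmem _ hgz) (hmem w hw)
  simp only [← hgz.2, ← hw.2] at hle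
  have : ‖w - g z‖ = 0 := by nlinarith [norm_nonneg (w - g z)]
  exact sub_eq_zero.1 (norm_eq_zero.1 this)

/-- Uniform contractivity on a neighbourhood of the closed unit disc with a disc around `1`
removed. -/
theorem exists_isContractive_away {q : ℕ → ℝ} (hq : CriticalWeights q)
    (hex : ∀ z : ℂ, ‖z‖ < 1 → ∃ w, ‖w‖ ≤ 1 ∧ w = z * pgf q w) {r : ℝ} (hr : 0 < r) :
    ∃ η > 0, ∃ δ > 0, ∀ z : ℂ, ‖z‖ < 1 + δ → r ≤ ‖z - 1‖ → IsContractive q η z := by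
  have hK : IsCompact (Metric.closedBall (0 : ℂ) 1 \ Metric.ball 1 (r / 2)) :=
    (isCompact_closedBall _ _).diff Metric.isOpen_ball
  have huni : ∃ η > 0, ∃ U : Set ℂ, IsOpen U ∧
      Metric.closedBall (0 : ℂ) 1 \ Metric.ball 1 (r / 2) ⊆ U ∧ ∀ z ∈ U, IsContractive q η z := by
    refine hK.induction_on (p := fun s => ∃ η > 0, ∃ U : Set ℂ, IsOpen U ∧ s ⊆ U ∧
      ∀ z ∈ U, IsContractive q η z) ?_ ?_ ?_ ?_
    · exact ⟨1, one_pos, ∅, isOpen_empty, subset_rfl, by simp⟩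
    · rintro s t hst ⟨η, hη, U, hU, htU, h⟩
      exact ⟨η, hη, U, hU, hst.trans htU, h⟩
    · rintro s t ⟨η, hη, U, hU, hsU, h⟩ ⟨η', hη', U', hU', htU', h'⟩
      refine ⟨min η η', lt_min hη hη', U ∪ U', hU.union hU', union_subset_union hsU htU', ?_⟩
      rintro z (hz | hz)
      · exact ⟨(h z hz).1, fun w hw => ((h z hz).2 w hw).trans (by linarith [min_le_left η η'])⟩
      · exact ⟨(h' z hz).1, fun w hw => ((h' z hz).2 w hw).trans (by linarith [min_le_right η η'])⟩
    · intro z hz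
      have hz1 : z ≠ 1 := fun h => hz.2 (h ▸ Metric.mem_ball_self (by linarith))
      obtain ⟨η, hη, hev⟩ := hq.exists_eventually_isContractive hex (by simpa using hz.1) hz1
      obtain ⟨U, hUsub, hU, hzU⟩ := mem_nhds_iff.1 hev
      exact ⟨U, mem_nhdsWithin_of_mem_nhds (hU.mem_nhds hzU), η, hη, U, hU, subset_rfl,
        fun z hz => hUsub hz⟩
  obtain ⟨η, hη, U, hU, hKU, h⟩ := huni
  obtain ⟨δ, hδ, hthick⟩ := hK.exists_thickening_subset_open hU hKU
  refine ⟨η, hη, min δ (r / 2), lt_min hδ (by linarith), fun z hz hzr => h z (hthick ?_)⟩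
  rw [Metric.mem_thickening_iff]
  rcases le_total ‖z‖ 1 with hz1 | hz1
  · refine ⟨z, ⟨by simpa using hz1, ?_⟩, by simpa using hδ⟩
    rw [mem_ball_iff_norm]
    linarith
  · have hdist : ‖z - z / ‖z‖‖ = ‖z‖ - 1 := by
      have h0 : (‖z‖ : ℂ) ≠ 0 := by
        exact_mod_cast (by linarith : (0 : ℝ) < ‖z‖).ne'
      have : z - z / ‖z‖ = ((‖z‖ - 1 : ℝ) : ℂ) * (z / ‖z‖) := by
        push_cast; field_simp
      rw [this, norm_mul, Complex.norm_real, Real.norm_of_nonneg (by linarith), norm_div,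
        Complex.norm_real, norm_norm, div_self (by linarith), mul_one]
    have hm1 := min_le_left δ (r / 2)
    have hm2 := min_le_right δ (r / 2)
    refine ⟨z / ‖z‖, ⟨?_, ?_⟩, ?_⟩
    · simp [div_self (by linarith : ‖z‖ ≠ 0)]
    · rw [mem_ball_iff_norm]
      have := norm_sub_le_norm_sub_add_norm_sub z (z / ‖z‖) 1
      linarith
    · rw [dist_eq_norm, hdist]; linarith

end CriticalWeights

/-- If `u ^ 2` is nearly a positive multiple of a number in a sector slightly larger than the right
half plane, then `u` lies in a sector well inside the right half plane. -/
theorem re_ge_of_sq_mul_eq {τ : ℝ} (hτ : 0 < τ) {u θ ζ : ℂ} (hθ : ‖θ - τ / 2‖ ≤ τ / 40)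
    (h : u ^ 2 * θ = ζ) (hζ : -(1 / 20) * ‖ζ‖ ≤ ζ.re) (hu : 0 ≤ u.re) :
    0.66 * ‖u‖ ≤ u.re := by
  have hθn : ‖θ‖ ≤ τ / 2 + τ / 40 := by
    have h1 : ‖(τ / 2 : ℂ)‖ = τ / 2 := by
      rw [norm_div, Complex.norm_real, Real.norm_of_nonneg hτ.le]; simp
    have := norm_le_norm_sub_add θ (τ / 2 : ℂ)
    linarith
  have hζn : ‖ζ‖ = ‖u‖ ^ 2 * ‖θ‖ := by rw [← h, norm_mul, norm_pow]
  have hre : ζ.re = (u ^ 2).re * (τ / 2) + (u ^ 2 * (θ - τ / 2)).re := by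
    have : ζ = u ^ 2 * ((τ / 2 : ℝ) : ℂ) + u ^ 2 * (θ - τ / 2) := by rw [← h]; push_cast; ring
    rw [this, Complex.add_re, Complex.re_mul_ofReal]
  have herr : (u ^ 2 * (θ - τ / 2)).re ≤ ‖u‖ ^ 2 * (τ / 40) := by
    refine (Complex.re_le_norm _).trans ?_
    rw [norm_mul, norm_pow]
    gcongr
  have hsq : (u ^ 2).re = 2 * u.re ^ 2 - ‖u‖ ^ 2 := by
    rw [← Complex.normSq_eq_norm_sq, Complex.normSq_apply, sq, Complex.mul_re]; ring
  rw [hsq] at hre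
  rw [hζn] at hζ
  have h1 : ‖u‖ ^ 2 * ‖θ‖ ≤ ‖u‖ ^ 2 * (τ / 2 + τ / 40) := by gcongr
  have h2 : τ * (0.44 * ‖u‖ ^ 2) ≤ τ * u.re ^ 2 := by nlinarith
  have h3 := le_of_mul_le_mul_left h2 hτ
  refine abs_le_of_sq_le_sq' ?_ hu |>.2
  nlinarith [norm_nonneg u]

theorem norm_add_ge_of_sector {y s : ℂ} (hy : -(1 / 20) * ‖y‖ ≤ y.re) (hs : 0.4 * ‖s‖ ≤ s.re) :
    0.2 * ‖y‖ ≤ ‖y + s‖ := by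
  have hy2 : ‖y‖ ^ 2 = y.re ^ 2 + y.im ^ 2 := by
    rw [← Complex.normSq_eq_norm_sq, Complex.normSq_apply]; ring
  have hs2 : ‖s‖ ^ 2 = s.re ^ 2 + s.im ^ 2 := by
    rw [← Complex.normSq_eq_norm_sq, Complex.normSq_apply]; ring
  have hys : ‖y + s‖ ^ 2 = ‖y‖ ^ 2 + ‖s‖ ^ 2 + 2 * (y.re * s.re + y.im * s.im) := by
    rw [hy2, hs2, ← Complex.normSq_eq_norm_sq, Complex.normSq_apply, Complex.add_re,
      Complex.add_im]; ring
  have hyn := norm_nonneg y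
  have hsn := norm_nonneg s
  have him : |s.im| ≤ 0.92 * ‖s‖ := abs_le_of_sq_le_sq (by nlinarith) (by positivity)
  have h1 : -(0.92 * (‖y‖ * ‖s‖)) ≤ y.im * s.im := by
    have : |y.im * s.im| ≤ ‖y‖ * (0.92 * ‖s‖) := by
      rw [abs_mul]
      exact mul_le_mul (Complex.abs_im_le_norm y) him (abs_nonneg _) hyn
    linarith [(abs_le.1 this).1]
  have h2 : -(1 / 20) * (‖y‖ * ‖s‖) ≤ y.re * s.re := by
    have hs0 : 0 ≤ s.re := le_trans (by positivity) hs
    have hsle := Complex.re_le_norm s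
    nlinarith [mul_le_mul_of_nonneg_right hy hs0, mul_le_mul_of_nonneg_left hsle hyn]
  refine abs_le_of_sq_le_sq' ?_ (norm_nonneg _) |>.2
  nlinarith [sq_nonneg (‖s‖ - 0.97 * ‖y‖)]

theorem norm_one_sub_mul_ge_of_sector {x a : ℂ} (hx : -(1 / 20) * ‖1 - x‖ ≤ (1 - x).re)
    (ha : 0.4 * ‖1 - a‖ ≤ (1 - a).re) (ha' : ‖1 - a‖ ≤ 0.1) :
    0.1 * ‖1 - x‖ ≤ ‖1 - x * a‖ := by
  have h1 := norm_add_ge_of_sector hx ha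
  have h2 : (1 - x) + (1 - a) = (1 - x * a) + (1 - x) * (1 - a) := by ring
  rw [h2] at h1
  have h3 := norm_add_le (1 - x * a) ((1 - x) * (1 - a))
  rw [norm_mul] at h3
  nlinarith [norm_nonneg (1 - x)]

namespace CriticalWeights

theorem exists_expansion_bounds {q : ℕ → ℝ} (hq : CriticalWeights q) :
    ∃ ε > 0, ε ≤ 0.01 ∧ ε * factorialMoment q ≤ 0.05 ∧ ∀ w : ℂ, ‖w‖ ≤ 1 → ‖w - 1‖ < ε →
      ‖pgfDerivQuot q w - factorialMoment q‖ ≤ factorialMoment q / 40 ∧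
      ‖pgfQuot q w / pgf q w - factorialMoment q / 2‖ ≤ factorialMoment q / 40 := by
  have hτ := hq.factorialMoment_pos
  set τ := factorialMoment q
  have h1 : (1 : ℂ) ∈ Metric.closedBall (0 : ℂ) 1 := by simp
  have hP : Tendsto (fun w => ‖pgfDerivQuot q w - τ‖) (𝓝[Metric.closedBall 0 1] 1) (𝓝 0) := by
    have := ((hq.continuousOn_pgfDerivQuot 1 h1).sub_const (τ : ℂ)).norm
    simpa [ContinuousWithinAt, pgfDerivQuot_one, τ] using this
  have hQ : Tendsto (fun w => ‖pgfQuot q w / pgf q w - τ / 2‖)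
      (𝓝[Metric.closedBall 0 1] 1) (𝓝 0) := by
    have := (((hq.continuousOn_pgfQuot 1 h1).div (hq.continuousOn_pgf 1 h1)
      (by simp [hq.pgf_one])).sub_const (τ / 2 : ℂ)).norm
    simpa [ContinuousWithinAt, pgfQuot_one, hq.pgf_one, τ] using this
  have hev := (hP.eventually_le_const (by positivity : 0 < τ / 40)).and
    (hQ.eventually_le_const (by positivity : 0 < τ / 40))
  obtain ⟨ε, hε, hball⟩ := Metric.mem_nhdsWithin_iff.1 hev
  refine ⟨min ε (min 0.01 (0.05 / τ)), by positivity,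
    (min_le_right _ _).trans (min_le_left _ _), ?_, fun w hw hw1 => hball ⟨?_, by simpa using hw⟩⟩
  · rw [← le_div_iff₀ hτ]
    exact (min_le_right _ _).trans (min_le_right _ _)
  · rw [mem_ball_iff_norm]
    exact hw1.trans_le (min_le_left _ _)

/-- The expansion of the multiplier at a solution near `1`. -/
theorem norm_multiplier_sub_le {τ : ℝ} (hτ : 0 < τ) {u ζ P : ℂ} (hu : ‖u‖ ≤ 0.01)
    (huτ : ‖u‖ * τ ≤ 0.05) (hP : ‖P - τ‖ ≤ τ / 40) (hζ : ‖ζ‖ ≤ 0.525 * τ * ‖u‖ ^ 2) :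
    ‖1 - (1 - ζ) * (1 - u * P) - τ * u‖ ≤ 0.05 * τ * ‖u‖ := by
  have hPn : ‖P‖ ≤ τ + τ / 40 := by
    have h1 : ‖(τ : ℂ)‖ = τ := by rw [Complex.norm_real, Real.norm_of_nonneg hτ.le]
    have := norm_le_norm_sub_add P (τ : ℂ)
    linarith
  have heq : 1 - (1 - ζ) * (1 - u * P) - τ * u = u * (P - τ) + ζ * (1 - u * P) := by ring
  have hun := norm_nonneg u
  have huP : ‖1 - u * P‖ ≤ 1.1 := by
    refine (norm_sub_le _ _).trans ?_
    rw [norm_one, norm_mul]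
    nlinarith
  rw [heq]
  refine (norm_add_le _ _).trans ?_
  rw [norm_mul, norm_mul]
  have h1 : ‖u‖ * ‖P - τ‖ ≤ ‖u‖ * (τ / 40) := by gcongr
  have h2 : ‖ζ‖ * ‖1 - u * P‖ ≤ (0.525 * τ * ‖u‖ ^ 2) * 1.1 := by gcongr
  have h3 : τ * ‖u‖ * ‖u‖ ≤ τ * ‖u‖ * 0.01 := by gcongr
  nlinarith

theorem eq_of_near_one {q : ℕ → ℝ} (hq : CriticalWeights q) {ε : ℝ} (hε1 : ε ≤ 0.01)
    (hετ : ε * factorialMoment q ≤ 0.05)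
    (hexp : ∀ w : ℂ, ‖w‖ ≤ 1 → ‖w - 1‖ < ε →
      ‖pgfDerivQuot q w - factorialMoment q‖ ≤ factorialMoment q / 40 ∧
      ‖pgfQuot q w / pgf q w - factorialMoment q / 2‖ ≤ factorialMoment q / 40)
    {z w v : ℂ} (hw : IsSolution q z w) (hv : IsSolution q z v) {M : ℝ} (hM0 : 0 < M)
    (hMε : M < ε) (hz : ‖1 - z‖ ≤ 0.525 * factorialMoment q * M ^ 2)
    (hw3 : 0.66 * ‖1 - w‖ ≤ (1 - w).re) (hv3 : 0.66 * ‖1 - v‖ ≤ (1 - v).re)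
    (hMw : ‖1 - w‖ ≤ M) (hMv : ‖1 - v‖ ≤ M) (hwM : 0.94 * M ≤ ‖1 - w‖)
    (hvM : 0.94 * M ≤ ‖1 - v‖) : w = v := by
  have hτ := hq.factorialMoment_pos
  generalize factorialMoment q = τ at *
  let S : Set ℂ := Metric.ball 0 1 ∩ {y | y.re ≤ 1 - 0.6 * M} ∩ Metric.closedBall 1 M
  have hconv : Convex ℝ S :=
    ((convex_ball _ _).inter (convex_halfSpace_re_le _)).inter (convex_closedBall _ _)
  have hzn : ‖z‖ ≤ 1 + 0.01 * (τ * M) := by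
    have h1 : ‖z‖ ≤ 1 + ‖1 - z‖ := by
      have := norm_sub_le (1 : ℂ) (1 - z)
      simpa using this
    have h2 : τ * M * M ≤ τ * M * 0.01 := by
      gcongr
      linarith
    nlinarith
  have hx0 : 0 < τ * M := by positivity
  have hx1 : τ * M ≤ 0.05 := by nlinarith
  have hbound : ∀ y ∈ S, ‖z * pgfDeriv q y‖ ≤ 1 - 0.4 * (τ * M) := by
    rintro y ⟨⟨hy1, hy2⟩, hy3⟩
    rw [mem_ball_zero_iff] at hy1
    rw [mem_closedBall_iff_norm] at hy3
    simp only [mem_ofPred_eq] at hy2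
    obtain ⟨hP, -⟩ := hexp y hy1.le (hy3.trans_lt hMε)
    rw [norm_sub_rev] at hy3
    have h1 : ‖(1 : ℂ) - τ * (1 - y)‖ ≤ 1 - 0.55 * (τ * M) := by
      refine (abs_le_of_sq_le_sq' ?_ (by linarith)).2
      have h2 : ‖(1 : ℂ) - τ * (1 - y)‖ ^ 2 =
          1 - 2 * τ * (1 - y.re) + τ ^ 2 * ‖1 - y‖ ^ 2 := by
        rw [← Complex.normSq_eq_norm_sq, ← Complex.normSq_eq_norm_sq, Complex.normSq_apply,
          Complex.normSq_apply]
        simp; ring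
      have h3 : τ ^ 2 * ‖1 - y‖ ^ 2 ≤ τ ^ 2 * M ^ 2 := by gcongr
      rw [h2]
      nlinarith
    have h4 : pgfDeriv q y = (1 - τ * (1 - y)) - (1 - y) * (pgfDerivQuot q y - τ) := by
      rw [hq.pgfDeriv_eq hy1.le]; ring
    have h5 : ‖pgfDeriv q y‖ ≤ 1 - 0.5 * (τ * M) := by
      rw [h4]
      refine (norm_sub_le _ _).trans ?_
      rw [norm_mul]
      have : ‖1 - y‖ * ‖pgfDerivQuot q y - τ‖ ≤ M * (τ / 40) := by gcongr
      linarith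
    rw [norm_mul]
    have : ‖z‖ * ‖pgfDeriv q y‖ ≤ (1 + 0.01 * (τ * M)) * (1 - 0.5 * (τ * M)) := by gcongr
    nlinarith
  have hmem : ∀ y, ‖y‖ < 1 → 0.66 * ‖1 - y‖ ≤ (1 - y).re → ‖1 - y‖ ≤ M →
      0.94 * M ≤ ‖1 - y‖ → y ∈ S := fun y h1 h2 h3 h4 => by
    refine ⟨⟨by simpa using h1, ?_⟩, by rwa [mem_closedBall_iff_norm, norm_sub_rev]⟩
    simp only [Complex.sub_re, Complex.one_re] at h2
    simp only [mem_ofPred_eq]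
    linarith
  have hle := hconv.norm_image_sub_le_of_norm_hasDerivWithin_le
    (f := fun w => z * pgf q w) (f' := fun w => z * pgfDeriv q w)
    (fun y hy => ((hq.hasDerivAt_pgf (mem_ball_zero_iff.1 hy.1.1)).const_mul z).hasDerivWithinAt)
    hbound (hmem v hv.1 hv3 hMv hvM) (hmem w hw.1 hw3 hMw hwM)
  simp only [← hw.2, ← hv.2] at hle
  have : ‖w - v‖ = 0 := by nlinarith [norm_nonneg (w - v)]
  exact sub_eq_zero.1 (norm_eq_zero.1 this)

theorem exists_near_one {q : ℕ → ℝ} (hq : CriticalWeights q) :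
    ∃ r > 0, r < 1 ∧ ∀ z : ℂ, ‖z - 1‖ < r → -(1 / 20) * ‖1 - z‖ < (1 - z).re →
      (∀ w, ‖w‖ ≤ 1 → w = z * pgf q w → ‖w‖ < 1) ∧
      (∀ w, IsSolution q z w → z * pgfDeriv q w ≠ 1 ∧ ‖1 - z * pgfDeriv q w‖ ≤ 0.1 ∧
        0.4 * ‖1 - z * pgfDeriv q w‖ ≤ (1 - z * pgfDeriv q w).re) ∧
      ∀ w v, IsSolution q z w → IsSolution q z v → w = v := by
  have hτ := hq.factorialMoment_pos
  obtain ⟨ε, hε, hε1, hετ, hexp⟩ := hq.exists_expansion_bounds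
  set τ := factorialMoment q
  have hclose := hq.eventually_solution_close (z₀ := 1) (w₀ := 1)
    (fun w hw h => hq.eq_of_eq (by simp) hw (by simp) h (by simp [hq.pgf_one])) hε
  obtain ⟨r, hr, hball⟩ := Metric.eventually_nhds_iff_ball.1 hclose
  refine ⟨min r 0.5, by positivity, (min_le_right _ _).trans_lt (by norm_num),
    fun z hz hsec => ?_⟩
  have hcl := hball z (mem_ball_iff_norm.2 (hz.trans_le (min_le_left _ _)))
  have hz1 : z ≠ 1 := by rintro rfl; simp at hsec
  have key : ∀ w, ‖w‖ ≤ 1 → w = z * pgf q w → 0 < ‖1 - w‖ ∧ ‖1 - w‖ < ε ∧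
      0.66 * ‖1 - w‖ ≤ (1 - w).re ∧ ‖1 - z‖ ≤ 0.525 * τ * ‖1 - w‖ ^ 2 ∧
      0.475 * τ * ‖1 - w‖ ^ 2 ≤ ‖1 - z‖ := by
    intro w hw heq
    have hc := hcl w hw heq
    obtain ⟨-, hQ⟩ := hexp w hw hc
    have hΦ := hq.pgf_ne_zero_of_eq heq
    have hζ : (1 - w) ^ 2 * (pgfQuot q w / pgf q w) = 1 - z := by
      rw [← mul_div_assoc, div_eq_iff hΦ]
      linear_combination -heq - hq.pgf_eq hw
    have hw1 : w ≠ 1 := by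
      rintro rfl
      rw [hq.pgf_one, mul_one] at heq
      exact hz1 heq.symm
    have hre : 0 ≤ (1 - w).re := by
      rw [Complex.sub_re, Complex.one_re]
      linarith [Complex.re_le_norm w]
    have hn : ‖1 - z‖ = ‖1 - w‖ ^ 2 * ‖pgfQuot q w / pgf q w‖ := by
      rw [← hζ, norm_mul, norm_pow]
    have h1 : ‖(τ / 2 : ℂ)‖ = τ / 2 := by
      rw [norm_div, Complex.norm_real, Real.norm_of_nonneg hτ.le]; simp
    have h2 := norm_le_norm_sub_add (pgfQuot q w / pgf q w) (τ / 2 : ℂ)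
    have h3 := norm_le_norm_sub_add (τ / 2 : ℂ) (pgfQuot q w / pgf q w)
    rw [norm_sub_rev] at h3
    refine ⟨norm_pos_iff.2 (sub_ne_zero.2 hw1.symm), by rwa [norm_sub_rev],
      re_ge_of_sq_mul_eq hτ hQ hζ hsec.le hre, ?_, ?_⟩ <;>
    · rw [hn]
      nlinarith [sq_nonneg ‖1 - w‖]
  refine ⟨fun w hw heq => ?_, fun w hw => ?_, fun w v hw hv => ?_⟩
  · obtain ⟨h1, h2, h3, -, -⟩ := key w hw heq
    have h4 : ‖w‖ ^ 2 = 1 - 2 * (1 - w).re + ‖1 - w‖ ^ 2 := by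
      rw [← Complex.normSq_eq_norm_sq, ← Complex.normSq_eq_norm_sq, Complex.normSq_apply,
        Complex.normSq_apply]
      simp; ring
    have h5 : ‖w‖ ^ 2 < 1 := by rw [h4]; nlinarith
    exact (sq_lt_one_iff₀ (norm_nonneg _)).1 h5
  · obtain ⟨h1, h2, h3, h4, -⟩ := key w hw.1.le hw.2
    obtain ⟨hP, -⟩ := hexp w hw.1.le (by rwa [norm_sub_rev])
    have huτ : ‖1 - w‖ * τ ≤ 0.05 := by nlinarith
    have hm := norm_multiplier_sub_le hτ (by linarith) huτ hP h4
    rw [← hq.pgfDeriv_eq hw.1.le, sub_sub_cancel] at hm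
    set s := 1 - z * pgfDeriv q w with hs
    have hτu : ‖(τ : ℂ) * (1 - w)‖ = τ * ‖1 - w‖ := by
      rw [norm_mul, Complex.norm_real, Real.norm_of_nonneg hτ.le]
    have hsn : ‖s‖ ≤ 1.05 * (τ * ‖1 - w‖) := by
      have := norm_le_norm_sub_add s ((τ : ℂ) * (1 - w))
      linarith
    have hsre : 0.61 * (τ * ‖1 - w‖) ≤ s.re := by
      have h5 := (abs_le.1 ((Complex.abs_re_le_norm _).trans hm)).1
      rw [Complex.sub_re, Complex.re_ofReal_mul] at h5
      nlinarith
    have hpos : 0 < τ * ‖1 - w‖ := by positivity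
    refine ⟨fun h => ?_, by nlinarith, by nlinarith⟩
    rw [hs, h, sub_self, Complex.zero_re] at hsre
    linarith
  · obtain ⟨hw1, hw2, hw3, hw4, hw5⟩ := key w hw.1.le hw.2
    obtain ⟨hv1, hv2, hv3, hv4, hv5⟩ := key v hv.1.le hv.2
    have hcomp : ∀ a b : ℝ, 0 < a → 0 < b → 0.475 * τ * a ^ 2 ≤ ‖1 - z‖ →
        ‖1 - z‖ ≤ 0.525 * τ * b ^ 2 → 0.94 * a ≤ b := fun a b ha hb h1 h2 => by
      have h3 : τ * (0.475 * a ^ 2) ≤ τ * (0.525 * b ^ 2) := by linarith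
      have h4 := le_of_mul_le_mul_left h3 hτ
      exact (abs_le_of_sq_le_sq' (by nlinarith) hb.le).2
    set M := max ‖1 - w‖ ‖1 - v‖ with hM
    have hMw : ‖1 - w‖ ≤ M := le_max_left _ _
    have hMv : ‖1 - v‖ ≤ M := le_max_right _ _
    have hMε : M < ε := max_lt hw2 hv2
    have hM0 : 0 < M := hw1.trans_le hMw
    have hwM : 0.94 * M ≤ ‖1 - w‖ := by
      rcases max_choice ‖1 - w‖ ‖1 - v‖ with h | h <;> rw [hM, h]
      · exact hcomp _ _ hw1 hw1 hw5 hw4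
      · exact hcomp _ _ hv1 hw1 hv5 hw4
    have hvM : 0.94 * M ≤ ‖1 - v‖ := by
      rcases max_choice ‖1 - w‖ ‖1 - v‖ with h | h <;> rw [hM, h]
      · exact hcomp _ _ hw1 hv1 hw5 hv4
      · exact hcomp _ _ hv1 hv1 hv5 hv4
    exact hq.eq_of_near_one hε1 hετ hexp hw hv hM0 hMε (hw4.trans (by gcongr)) hw3 hv3 hMw hMv
      hwM hvM

end CriticalWeights

/-- An open sector with vertex `1`, slightly larger than the half plane `re z < 1`. -/
def sectorAtOne : Set ℂ := {z | -(1 / 20) * ‖1 - z‖ < (1 - z).re}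

theorem isOpen_sectorAtOne : IsOpen sectorAtOne :=
  isOpen_lt (by fun_prop) (Complex.continuous_re.comp (by fun_prop))

theorem mem_sectorAtOne_of_norm_lt_one {z : ℂ} (hz : ‖z‖ < 1) : z ∈ sectorAtOne := by
  have h1 := Complex.re_le_norm z
  have h2 : -(1 / 20) * ‖1 - z‖ ≤ 0 := by nlinarith [norm_nonneg (1 - z)]
  simp only [sectorAtOne, mem_ofPred_eq, Complex.sub_re, Complex.one_re]
  linarith

theorem starConvex_sectorAtOne {t : ℝ} (ht : t < 1) :
    StarConvex ℝ (t : ℂ) sectorAtOne := by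
  rw [starConvex_iff_segment_subset]
  rintro z hz _ ⟨a, b, ha, hb, hab, rfl⟩
  simp only [sectorAtOne, mem_ofPred_eq] at hz ⊢
  have hdecomp : (1 : ℂ) - (a • (t : ℂ) + b • z) = ((a * (1 - t) : ℝ) : ℂ) + (b : ℂ) * (1 - z) := by
    have : (a : ℂ) + b = 1 := by exact_mod_cast hab
    simp only [Complex.real_smul]
    push_cast
    linear_combination -this
  rw [hdecomp, Complex.add_re, Complex.ofReal_re, Complex.re_ofReal_mul]
  have h0 : 0 ≤ a * (1 - t) := mul_nonneg ha (by linarith)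
  have h1 : b * ‖1 - z‖ ≤ ‖((a * (1 - t) : ℝ) : ℂ) + (b : ℂ) * (1 - z)‖ + a * (1 - t) := by
    have := norm_sub_le (((a * (1 - t) : ℝ) : ℂ) + (b : ℂ) * (1 - z)) ((a * (1 - t) : ℝ) : ℂ)
    rwa [add_sub_cancel_left, norm_mul, Complex.norm_real, Complex.norm_real,
      Real.norm_of_nonneg h0, Real.norm_of_nonneg hb] at this
  rcases ha.eq_or_lt with rfl | ha'
  · obtain rfl : b = 1 := by linarith
    simp only [zero_mul, Complex.ofReal_zero, zero_add, Complex.ofReal_one, one_mul]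
    exact hz
  · have : 0 < a * (1 - t) := mul_pos ha' (by linarith)
    nlinarith [mul_le_mul_of_nonneg_left hz.le hb]

namespace CriticalWeights

/-- Near `1`, solutions exist throughout the sector, by connectedness. -/
theorem exists_isSolution_near_one {q : ℕ → ℝ} (hq : CriticalWeights q)
    (hex : ∀ z : ℂ, ‖z‖ < 1 → ∃ w, ‖w‖ ≤ 1 ∧ w = z * pgf q w) {r : ℝ} (hr : 0 < r) (hr1 : r < 1)
    (hclosed : ∀ z ∈ Metric.ball 1 r ∩ sectorAtOne, ∀ w, ‖w‖ ≤ 1 → w = z * pgf q w → ‖w‖ < 1)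
    (hmult : ∀ z ∈ Metric.ball 1 r ∩ sectorAtOne, ∀ w, IsSolution q z w →
      z * pgfDeriv q w ≠ 1) {z : ℂ} (hz : z ∈ Metric.ball 1 r ∩ sectorAtOne) :
    ∃ w, IsSolution q z w := by
  set S : Set ℂ := Metric.ball 1 r ∩ sectorAtOne with hS
  have hSopen : IsOpen S := Metric.isOpen_ball.inter isOpen_sectorAtOne
  set a : ℝ := 1 - r / 2 with ha
  have hnorm : ‖(a : ℂ)‖ < 1 := by
    rw [Complex.norm_real, Real.norm_of_nonneg (by linarith)]; linarith
  have haS : (a : ℂ) ∈ S := by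
    refine ⟨?_, mem_sectorAtOne_of_norm_lt_one hnorm⟩
    have : (a : ℂ) - 1 = ((-(r / 2) : ℝ) : ℂ) := by rw [ha]; push_cast; ring
    rw [mem_ball_iff_norm, this, Complex.norm_real, norm_neg, Real.norm_of_nonneg (by linarith)]
    linarith
  have hSconn : IsPreconnected S :=
    ((((convex_ball (1 : ℂ) r).starConvex haS.1).inter
      (starConvex_sectorAtOne (by linarith))).isPathConnected haS).isConnected.isPreconnected
  have hu : IsOpen {z | z ∈ S ∧ ∃ w, IsSolution q z w} := by
    rw [isOpen_iff_eventually]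
    rintro z ⟨hzS, w, hw⟩
    obtain ⟨g, -, hg⟩ := hq.exists_local_branch hw (hmult z hzS w hw)
    filter_upwards [hg, hSopen.mem_nhds hzS] with y hy hyS
    exact ⟨hyS, g y, hy⟩
  have hsub := hSconn.subset_of_closure_inter_subset hu ?_ ?_
  · exact (hsub hz).2
  · obtain ⟨w, hw, heq⟩ := hex a hnorm
    exact ⟨a, haS, haS, w, hclosed a haS w hw heq, heq⟩
  · rintro y ⟨hy, hyS⟩
    obtain ⟨w, hw, heq⟩ := closure_minimal (t := {z : ℂ | ∃ w, ‖w‖ ≤ 1 ∧ w = z * pgf q w})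
      (by rintro z ⟨_, w, hw⟩; exact ⟨w, hw.1.le, hw.2⟩) hq.isClosed_solvable hy
    exact ⟨hyS, w, hclosed y hyS w hw heq, heq⟩

theorem exists_analytic_solution {q : ℕ → ℝ} (hq : CriticalWeights q)
    (hex : ∀ z : ℂ, ‖z‖ < 1 → ∃ w, ‖w‖ ≤ 1 ∧ w = z * pgf q w) :
    ∃ δ > 0, ∃ c > 0, ∃ F : ℂ → ℂ,
      AnalyticOnNhd ℂ F (Metric.ball 0 (1 + δ) ∩ sectorAtOne) ∧
      (∀ z ∈ Metric.ball 0 (1 + δ) ∩ sectorAtOne, IsSolution q z (F z)) ∧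
      ∀ x ∈ Metric.ball 0 (1 + δ) ∩ sectorAtOne, ∀ z ∈ Metric.ball 0 (1 + δ) ∩ sectorAtOne,
        c * ‖1 - x‖ ≤ ‖1 - x * z * pgfDeriv q (F z)‖ := by
  obtain ⟨r, hr, hr1, hnear⟩ := hq.exists_near_one
  obtain ⟨η, hη, δ₀, hδ₀, haway⟩ := hq.exists_isContractive_away hex hr
  have hsolnear : ∀ z ∈ Metric.ball 1 r ∩ sectorAtOne, ∃ w, IsSolution q z w := fun z hz =>
    hq.exists_isSolution_near_one hex hr hr1
      (fun z hz => (hnear z (mem_ball_iff_norm.1 hz.1) hz.2).1)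
      (fun z hz w hw => ((hnear z (mem_ball_iff_norm.1 hz.1) hz.2).2.1 w hw).1) hz
  set δ := min δ₀ (min η 1) with hδ
  have hδpos : 0 < δ := lt_min hδ₀ (lt_min hη one_pos)
  have hδ0 : δ ≤ δ₀ := min_le_left _ _
  have hδη : δ ≤ η := (min_le_right _ _).trans (min_le_left _ _)
  have hδ1 : δ ≤ 1 := (min_le_right _ _).trans (min_le_right _ _)
  set U : Set ℂ := Metric.ball 0 (1 + δ) ∩ sectorAtOne with hU
  have hUopen : IsOpen U := Metric.isOpen_ball.inter isOpen_sectorAtOne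
  have haway' : ∀ z ∈ U, r ≤ ‖z - 1‖ → IsContractive q η z := fun z hz hzr =>
    haway z (by linarith [mem_ball_zero_iff.1 hz.1]) hzr
  have huniq : ∀ z ∈ U, ∃! w, IsSolution q z w := fun z hz => by
    rcases lt_or_ge ‖z - 1‖ r with h | h
    · obtain ⟨w, hw⟩ := hsolnear z ⟨mem_ball_iff_norm.2 h, hz.2⟩
      exact ⟨w, hw, fun v hv => (hnear z h hz.2).2.2 v w hv hw⟩
    · exact (haway' z hz h).1
  choose! F hF hFuniq using huniq
  have hmult : ∀ z ∈ U, z * pgfDeriv q (F z) ≠ 1 := fun z hz => by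
    rcases lt_or_ge ‖z - 1‖ r with h | h
    · exact ((hnear z h hz.2).2.1 _ (hF z hz)).1
    · intro heq
      have := (haway' z hz h).2 _ (hF z hz)
      rw [heq, norm_one] at this
      linarith
  refine ⟨δ, hδpos, min 0.1 (η ^ 2 / 3), by positivity, F, ?_, hF, fun x hx z hz => ?_⟩
  · refine DifferentiableOn.analyticOnNhd (fun z hz => ?_) hUopen
    obtain ⟨g, hg, hsol⟩ := hq.exists_local_branch (hF z hz) (hmult z hz)
    refine (hg.congr_of_eventuallyEq ?_).differentiableWithinAt
    filter_upwards [hsol, hUopen.mem_nhds hz] with y hy hyU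
    exact (hFuniq y hyU _ hy).symm
  · rw [mul_assoc]
    rcases lt_or_ge ‖z - 1‖ r with h | h
    · obtain ⟨-, h1, h2⟩ := (hnear z h hz.2).2.1 _ (hF z hz)
      refine le_trans ?_ (norm_one_sub_mul_ge_of_sector hx.2.le h2 h1)
      gcongr
      exact min_le_left _ _
    · have h1 := (haway' z hz h).2 _ (hF z hz)
      have hxn := mem_ball_zero_iff.1 hx.1
      have h2 : ‖1 - x‖ ≤ 3 := by
        have := norm_sub_le 1 x
        rw [norm_one] at this
        linarith
      have h3 : η ^ 2 ≤ ‖1 - x * (z * pgfDeriv q (F z))‖ := by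
        have h4 := norm_sub_norm_le 1 (x * (z * pgfDeriv q (F z)))
        rw [norm_one, norm_mul] at h4
        have h5 : ‖x‖ * ‖z * pgfDeriv q (F z)‖ ≤ (1 + η) * (1 - η) := by
          gcongr
          linarith
        nlinarith
      calc min 0.1 (η ^ 2 / 3) * ‖1 - x‖ ≤ η ^ 2 / 3 * 3 := by
            gcongr
            exact min_le_right _ _
        _ ≤ _ := by linarith

end CriticalWeights

namespace PlaneTree

theorem subtreeAt_node_cons (ts : List PlaneTree) (i : Fin ts.length) (v : List ℕ) :
    subtreeAt (.node ts) ((i : ℕ) :: v) = subtreeAt (ts.get i) v := by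
  simp [subtreeAt]

theorem childCount_node_cons (ts : List PlaneTree) (i : Fin ts.length) (v : List ℕ) :
    childCount (.node ts) ((i : ℕ) :: v) = childCount (ts.get i) v := by
  simp only [childCount, subtreeAt_node_cons]

theorem childCount_node_nil (ts : List PlaneTree) : childCount (.node ts) [] = ts.length := by
  simp [childCount, subtreeAt, children]

theorem vertexSet_node (ts : List PlaneTree) :
    vertexSet (.node ts) = {[]} ∪ ⋃ i : Fin ts.length,
      (fun v => (i : ℕ) :: v) '' vertexSet (ts.get i) := by
  ext v
  simp only [mem_union, mem_singleton_iff, mem_iUnion, mem_image]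
  constructor
  · intro hv
    rcases v with _ | ⟨i, v⟩
    · exact Or.inl rfl
    · right
      by_cases hi : i < ts.length
      · refine ⟨⟨i, hi⟩, v, ?_, rfl⟩
        have : (subtreeAt (.node ts) (i :: v)).isSome := hv
        rwa [subtreeAt_node_cons ts ⟨i, hi⟩] at this
      · have : (subtreeAt (.node ts) (i :: v)).isSome := hv
        simp [subtreeAt, hi] at this
  · rintro (rfl | ⟨i, v, hv, rfl⟩)
    · simp [vertexSet, subtreeAt]
    · change (subtreeAt (.node ts) ((i : ℕ) :: v)).isSome
      rw [subtreeAt_node_cons]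
      exact hv

theorem finite_vertexSet : ∀ t : PlaneTree, (vertexSet t).Finite
  | .node ts => by
    rw [vertexSet_node]
    exact (finite_singleton _).union
      (finite_iUnion fun i => (finite_vertexSet (ts.get i)).image _)
  termination_by t => sizeOf t
  decreasing_by
    have := List.sizeOf_lt_of_mem (List.get_mem ts i)
    simp only [PlaneTree.node.sizeOf_spec]
    omega

/-- A product over the vertices of a tree splits into the root and the root's subtrees. -/
@[to_additive]
theorem finprod_mem_vertexSet_node {M : Type*} [CommMonoid M] (ts : List PlaneTree)
    (f : List ℕ → M) :
    ∏ᶠ v ∈ vertexSet (.node ts), f v =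
      f [] * ∏ i : Fin ts.length, ∏ᶠ v ∈ vertexSet (ts.get i), f ((i : ℕ) :: v) := by
  have hfin : ∀ i : Fin ts.length,
      ((fun v => (i : ℕ) :: v) '' vertexSet (ts.get i)).Finite := fun i =>
    (finite_vertexSet _).image _
  rw [vertexSet_node, finprod_mem_union _ (finite_singleton _) (finite_iUnion hfin),
    finprod_mem_singleton, finprod_mem_iUnion _ hfin, finprod_eq_prod_of_fintype]
  · congr 1
    refine Finset.prod_congr rfl fun i _ => ?_
    exact finprod_mem_image fun a _ b _ h => by simpa using h
  · intro i j hij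
    rw [Function.onFun, Set.disjoint_left]
    rintro _ ⟨a, _, rfl⟩ ⟨b, _, h⟩
    exact hij (Fin.ext (List.cons.inj h).1.symm)
  · rw [Set.disjoint_left]
    simp

theorem size_node (ts : List PlaneTree) :
    size (.node ts) = 1 + ∑ i : Fin ts.length, size (ts.get i) := by
  have h : ∀ t : PlaneTree, size t = ∑ᶠ v ∈ vertexSet t, 1 := fun t => by
    rw [finsum_one, size]
  simp only [h]
  exact finsum_mem_vertexSet_node ts fun _ => 1

theorem gwProb_node (p : ℕ → ℝ≥0∞) (ts : List PlaneTree) :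
    gwProb p (.node ts) = p ts.length * ∏ i : Fin ts.length, gwProb p (ts.get i) := by
  unfold gwProb
  rw [finprod_mem_vertexSet_node, childCount_node_nil]
  simp only [childCount_node_cons]

/-- A plane tree is the same as the tuple of the subtrees of its root. -/
def equivTuple : PlaneTree ≃ Σ n, Fin n → PlaneTree where
  toFun t := List.equivSigmaTuple t.children
  invFun x := .node (List.equivSigmaTuple.symm x)
  left_inv := fun ⟨ts⟩ =>
    congrArg PlaneTree.node (List.equivSigmaTuple.symm_apply_apply ts)
  right_inv x := List.equivSigmaTuple.apply_symm_apply x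

theorem gwProb_eq (p : ℕ → ℝ≥0∞) (t : PlaneTree) :
    gwProb p t = p (equivTuple t).1 * ∏ i, gwProb p ((equivTuple t).2 i) := by
  obtain ⟨ts⟩ := t
  exact gwProb_node p ts

theorem size_eq (t : PlaneTree) : size t = 1 + ∑ i, size ((equivTuple t).2 i) := by
  obtain ⟨ts⟩ := t
  exact size_node ts

end PlaneTree

theorem ENNReal.tsum_prod_tuple {α : Type*} (f : α → ℝ≥0∞) (k : ℕ) :
    ∑' v : Fin k → α, ∏ i, f (v i) = (∑' a, f a) ^ k := by
  induction k with
  | zero => simp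
  | succ k ih =>
    rw [← (Fin.consEquiv fun _ : Fin (k + 1) => α).tsum_eq, ENNReal.tsum_prod']
    simp only [Fin.consEquiv_apply, Fin.prod_univ_succ, Fin.cons_zero, Fin.cons_succ]
    simp only [ENNReal.tsum_mul_left, ih, ENNReal.tsum_mul_right]
    rw [pow_succ']

theorem summable_and_tsum_prod_tuple {α : Type*} {f : α → ℂ} (hf : Summable fun a => ‖f a‖)
    (k : ℕ) : (Summable fun v : Fin k → α => ‖∏ i, f (v i)‖) ∧
      ∑' v : Fin k → α, ∏ i, f (v i) = (∑' a, f a) ^ k := by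
  induction k with
  | zero => exact ⟨Summable.of_finite, by simp⟩
  | succ k ih =>
    rw [← (Fin.consEquiv fun _ : Fin (k + 1) => α).tsum_eq,
      ← (Fin.consEquiv fun _ : Fin (k + 1) => α).summable_iff]
    simp only [Function.comp_def, Fin.consEquiv_apply, Fin.prod_univ_succ, Fin.cons_zero,
      Fin.cons_succ]
    refine ⟨Summable.mul_norm (f := f) (g := fun v : Fin k → α => ∏ i, f (v i)) hf ih.1, ?_⟩
    rw [← tsum_mul_tsum_of_summable_norm hf ih.1, ih.2, pow_succ']

theorem tsum_gwProb_le_one {p : ℕ → ℝ≥0∞} (hp : ∑' k : ℕ, p k = 1) :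
    ∑' t : PlaneTree, gwProb p t ≤ 1 := by
  have htrunc : ∀ n : ℕ, ∑' t : PlaneTree, (if t.size ≤ n then gwProb p t else 0) ≤ 1 := by
    intro n
    induction n with
    | zero =>
      have : ∀ t : PlaneTree, ¬ t.size ≤ 0 := fun t => by rw [PlaneTree.size_eq]; omega
      simp [this]
    | succ n ih =>
      set g : PlaneTree → ℝ≥0∞ := fun t => if t.size ≤ n then gwProb p t else 0 with hg
      calc ∑' t : PlaneTree, (if t.size ≤ n + 1 then gwProb p t else 0)
          ≤ ∑' t : PlaneTree, p (PlaneTree.equivTuple t).1 *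
              ∏ i, g ((PlaneTree.equivTuple t).2 i) := by
            refine ENNReal.tsum_le_tsum fun t => ?_
            split_ifs with ht
            · rw [PlaneTree.gwProb_eq]
              refine mul_le_mul_right (Finset.prod_le_prod' fun i _ => ?_) _
              have hi := Finset.single_le_sum
                (f := fun i => ((PlaneTree.equivTuple t).2 i).size) (fun _ _ => Nat.zero_le _)
                (Finset.mem_univ i)
              rw [PlaneTree.size_eq] at ht
              simp only [hg]
              rw [if_pos (by omega)]
            · exact zero_le
        _ = ∑' k : ℕ, p k * (∑' t, g t) ^ k := by
            rw [PlaneTree.equivTuple.tsum_eq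
              (fun x : Σ k, Fin k → PlaneTree => p x.1 * ∏ i, g (x.2 i)), ENNReal.tsum_sigma']
            simp only [ENNReal.tsum_mul_left, ENNReal.tsum_prod_tuple]
        _ ≤ ∑' k : ℕ, p k := by
            refine ENNReal.tsum_le_tsum fun k => ?_
            exact mul_le_of_le_one_right' (pow_le_one' ih k)
        _ = 1 := hp
  rw [ENNReal.tsum_eq_iSup_sum]
  refine iSup_le fun s => ?_
  refine le_trans ?_ ((ENNReal.sum_le_tsum s).trans (htrunc (s.sup PlaneTree.size)))
  refine Finset.sum_le_sum fun t ht => ?_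
  rw [if_pos (Finset.le_sup (f := PlaneTree.size) ht)]

theorem norm_Fgen_le_one_and_eq {p : ℕ → ℝ≥0∞} (hp : ∑' k : ℕ, p k = 1) {z : ℂ} (hz : ‖z‖ < 1) :
    ‖Fgen p z‖ ≤ 1 ∧ Fgen p z = z * pgf (fun k => (p k).toReal) (Fgen p z) := by
  have hgw := tsum_gwProb_le_one hp
  have hgw' : ∑' t : PlaneTree, gwProb p t ≠ ⊤ := (hgw.trans_lt ENNReal.one_lt_top).ne
  set f : PlaneTree → ℂ := fun t => ((gwProb p t).toReal : ℂ) * z ^ t.size with hf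
  have hnorm : ∀ t, ‖f t‖ ≤ (gwProb p t).toReal := fun t => by
    rw [hf, norm_mul, norm_pow, Complex.norm_real, Real.norm_of_nonneg ENNReal.toReal_nonneg]
    exact mul_le_of_le_one_right ENNReal.toReal_nonneg (pow_le_one₀ (norm_nonneg _) hz.le)
  have hsum : HasSum (fun t => (gwProb p t).toReal) (∑' t, gwProb p t).toReal := by
    rw [ENNReal.tsum_toReal_eq fun t => ENNReal.ne_top_of_tsum_ne_top hgw' t]
    exact ENNReal.hasSum_toReal hgw'
  have hfs : Summable fun t => ‖f t‖ :=
    .of_nonneg_of_le (fun _ => norm_nonneg _) hnorm hsum.summable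
  refine ⟨(tsum_of_norm_bounded hsum hnorm).trans
    (ENNReal.toReal_mono ENNReal.one_ne_top hgw), ?_⟩
  set h : (Σ k, Fin k → PlaneTree) → ℂ := fun x =>
    z * (p x.1).toReal * ∏ i, f (x.2 i) with hh
  have hfh : ∀ t, f t = h (PlaneTree.equivTuple t) := fun t => by
    simp only [hf, hh]
    rw [PlaneTree.gwProb_eq, PlaneTree.size_eq, ENNReal.toReal_mul, ENNReal.toReal_prod,
      Finset.prod_mul_distrib, Finset.prod_pow_eq_pow_sum, pow_add, pow_one]
    push_cast
    ring
  have hsh : Summable h := by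
    rw [← PlaneTree.equivTuple.summable_iff]
    exact hfs.of_norm.congr hfh
  calc Fgen p z = ∑' t, f t := rfl
    _ = ∑' x, h x := by rw [tsum_congr hfh, PlaneTree.equivTuple.tsum_eq h]
    _ = ∑' k, ∑' v : Fin k → PlaneTree, h ⟨k, v⟩ := hsh.tsum_sigma
    _ = ∑' k, z * ((p k).toReal * Fgen p z ^ k) := by
        refine tsum_congr fun k => ?_
        simp only [hh]
        rw [tsum_mul_left, (summable_and_tsum_prod_tuple hfs k).2, mul_assoc]
        rfl
    _ = _ := by rw [tsum_mul_left, pgf]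

theorem criticalWeights_toReal {p : ℕ → ℝ≥0∞} (hp : ∑' k : ℕ, p k = 1)
    (hmean : ∑' k : ℕ, (k : ℝ≥0∞) * p k = 1)
    (hvar_pos : 0 < xiVar p) (hvar_fin : xiVar p ≠ ⊤)
    (hspan : ∀ e : ℕ, (∀ k : ℕ, p k ≠ 0 → e ∣ k) → e ≤ 1) :
    CriticalWeights fun k => (p k).toReal := by
  have htop : ∀ k, p k ≠ ⊤ := ENNReal.ne_top_of_tsum_ne_top (by simp [hp])
  have hnn : ∀ k, 0 ≤ (p k).toReal := fun k => ENNReal.toReal_nonneg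
  have h1 : HasSum (fun k => (p k).toReal) 1 := by
    have := ENNReal.hasSum_toReal (f := p) (by simp [hp])
    rwa [← ENNReal.tsum_toReal_eq htop, hp, ENNReal.toReal_one] at this
  have hm : HasSum (fun k : ℕ => (k : ℝ) * (p k).toReal) 1 := by
    have := ENNReal.hasSum_toReal (f := fun k : ℕ => (k : ℝ≥0∞) * p k) (by simp [hmean])
    rw [← ENNReal.tsum_toReal_eq
      (fun k => ENNReal.mul_ne_top (ENNReal.natCast_ne_top k) (htop k)), hmean,
      ENNReal.toReal_one] at this
    simpa using this
  have hv : Summable fun k : ℕ => (p k).toReal * ((k : ℝ) - 1) ^ 2 := by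
    have := (ENNReal.hasSum_toReal hvar_fin).summable
    simpa [ENNReal.toReal_ofReal, sq_nonneg] using this
  have hdiff : HasSum (fun k : ℕ => ((k : ℝ) - 1) * (p k).toReal) 0 := by
    simpa [sub_mul] using hm.sub h1
  have hnontriv : ¬ ∀ k : ℕ, ((k : ℝ) - 1) * (p k).toReal = 0 := fun h => by
    refine hvar_pos.ne' (ENNReal.tsum_eq_zero.2 fun k => ?_)
    rcases mul_eq_zero.1 (h k) with h | h
    · simp [h]
    · rcases (ENNReal.toReal_eq_zero_iff _).1 h with h | h
      · simp [h]
      · exact absurd h (htop k)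
  have hzero : 0 < (p 0).toReal := by
    refine (hnn 0).lt_of_ne fun h0 => hnontriv fun k => ?_
    refine congrFun ((hasSum_zero_iff_of_nonneg fun k => ?_).1 hdiff) k
    rcases k with _ | k
    · simp [← h0]
    · exact mul_nonneg (by simp) (hnn _)
  have htwo : ∃ k, 2 ≤ k ∧ 0 < (p k).toReal := by
    by_contra! hcon
    refine hnontriv fun k => ?_
    have hneg : HasSum (fun k : ℕ => -(((k : ℝ) - 1) * (p k).toReal)) 0 := by simpa using hdiff.neg
    refine neg_eq_zero.1 (congrFun ((hasSum_zero_iff_of_nonneg fun k => ?_).1 hneg) k)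
    rcases lt_or_ge k 2 with hk | hk
    · have : (k : ℝ) ≤ 1 := by exact_mod_cast Nat.lt_succ_iff.1 hk
      exact neg_nonneg.2 (mul_nonpos_of_nonpos_of_nonneg (by linarith) (hnn k))
    · simp [le_antisymm (hcon k hk) (hnn k)]
  refine ⟨hnn, h1, hm, ?_, hzero, htwo, fun w hw => ?_⟩
  · refine .of_nonneg_of_le (fun k => mul_nonneg (sq_nonneg _) (hnn k)) (fun k => ?_)
      ((hv.mul_left 2).add (h1.summable.mul_left 2))
    nlinarith [mul_nonneg (hnn k) (sq_nonneg ((k : ℝ) - 2))]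
  · have hdvd : ∀ k, p k ≠ 0 → orderOf w ∣ k := fun k hk =>
      orderOf_dvd_of_pow_eq_one (hw k (ENNReal.toReal_ne_zero.2 ⟨hk, htop k⟩))
    obtain ⟨k, hk, hqk⟩ := htwo
    have hpos : 0 < orderOf w := by
      refine Nat.pos_of_ne_zero fun h0 => ?_
      have := hdvd k (ENNReal.toReal_ne_zero.1 hqk.ne').1
      rw [h0, zero_dvd_iff] at this
      omega
    exact orderOf_eq_one_iff.1 (le_antisymm (hspan _ hdvd) hpos)

theorem Delta_subset {β δ : ℝ} (hβ0 : 0 ≤ β) (hβ : β ≤ 1 / 20) :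
    Delta β δ ⊆ Metric.ball 0 (1 + δ) ∩ sectorAtOne := by
  rintro z ⟨hz, hz1, harg⟩
  refine ⟨by simpa using hz, ?_⟩
  have hne : z - 1 ≠ 0 := sub_ne_zero.2 hz1
  have hcos : Real.cos (Complex.arg (z - 1)) < 1 / 20 := by
    rw [← Real.cos_abs]
    have h1 : Real.cos |Complex.arg (z - 1)| < Real.cos (Real.pi / 2 - β) :=
      Real.cos_lt_cos_of_nonneg_of_le_pi (by linarith [Real.pi_gt_three])
        (Complex.abs_arg_le_pi _) harg
    rw [Real.cos_pi_div_two_sub] at h1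
    linarith [Real.sin_le hβ0]
  rw [Complex.cos_arg hne, div_lt_iff₀ (norm_pos_iff.2 hne)] at hcos
  simp only [sectorAtOne, mem_ofPred_eq]
  rw [norm_sub_rev, Complex.sub_re]
  rw [Complex.sub_re] at hcos
  linarith

/-- inequality (4.5) of Lemma 7 of Devroye–Janson.  If `ξ` has span 1,
then there are `β, δ, c₂ > 0` such that `F` extends analytically to `Δ(β, δ)` with
`|1 - x z Φ'(F(z))| ≥ c₂ |1 - x|` for all `x, z ∈ Δ(β, δ)`. -/
theorem one_sub_xzPhiF_lower_bound
    (p : ℕ → ℝ≥0∞) (hp : ∑' k : ℕ, p k = 1)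
    (hmean : ∑' k : ℕ, (k : ℝ≥0∞) * p k = 1)
    (hvar_pos : 0 < xiVar p) (hvar_fin : xiVar p ≠ ⊤)
    (hspan : ∀ e : ℕ, (∀ k : ℕ, p k ≠ 0 → e ∣ k) → e ≤ 1) :
    ∃ β δ c₂ : ℝ, 0 < β ∧ β < Real.pi / 2 ∧ 0 < δ ∧ 0 < c₂ ∧
      ∃ F : ℂ → ℂ, AnalyticOnNhd ℂ F (Metric.ball (0 : ℂ) 1 ∪ Delta β δ) ∧
        (∀ z ∈ Metric.ball (0 : ℂ) 1, F z = Fgen p z) ∧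
        ∀ x ∈ Delta β δ, ∀ z ∈ Delta β δ,
          c₂ * ‖1 - x‖ ≤ ‖1 - x * z * PhiDeriv p (F z)‖ := by
  have hq := criticalWeights_toReal hp hmean hvar_pos hvar_fin hspan
  obtain ⟨δ, hδ, c, hc, F, hF, hsol, hbound⟩ := hq.exists_analytic_solution fun z hz =>
    ⟨Fgen p z, norm_Fgen_le_one_and_eq hp hz⟩
  have hsub : Delta (1 / 20) δ ⊆ Metric.ball 0 (1 + δ) ∩ sectorAtOne :=
    Delta_subset (by norm_num) le_rfl
  have hball : Metric.ball (0 : ℂ) 1 ⊆ Metric.ball 0 (1 + δ) ∩ sectorAtOne := fun z hz =>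
    ⟨Metric.ball_subset_ball (by linarith) hz,
      mem_sectorAtOne_of_norm_lt_one (mem_ball_zero_iff.1 hz)⟩
  refine ⟨1 / 20, δ, c, by norm_num, by linarith [Real.pi_gt_three], hδ, hc, F,
    hF.mono (union_subset hball hsub), fun z hz => ?_,
    fun x hx z hz => hbound x (hsub hx) z (hsub hz)⟩
  have hz1 := mem_ball_zero_iff.1 hz
  obtain ⟨h1, h2⟩ := norm_Fgen_le_one_and_eq hp hz1
  obtain ⟨h3, h4⟩ := hsol z (hball hz)
  exact hq.eq_of_eq hz1.le h3.le h1 h4 h2
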